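/- Let F be smooth on a punctured neighbourhood of y ∈ ℝ³ and assume that F together with all its first and second partial derivatives admit singular expansions at y. Then for all i, j ∈ {1,2,3} the Hadamard parties finies at y satisfy (∂_i∂_jF)_y = ((15 nⁱnʲ − 3δ^{ij}) r^{−2} F)_y; in particular, taking the trace, (ΔF)_y = (6 r^{−2} F)_y, and also (r² ΔF)_y = 0. -/

import Mathlib

open MeasureTheory Filter Topology Real Asymptotics

noncomputable section

abbrev E3 : Type := EuclideanSpace ℝ (Fin 3)
abbrev S2 : Type := Metric.sphere (0 : E3) 1

/-- The surface measure `dΩ` on the unit sphere `S²` (total mass `4π`). -/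
def dOmega : Measure S2 := (volume : Measure E3).toSphere

/-- A function on the unit sphere is smooth iff it is the restriction of
a smooth function on `ℝ³`. -/
def SmoothSphereFn (f : S2 → ℝ) : Prop :=
  ∃ g : E3 → ℝ, ContDiff ℝ (⊤ : ℕ∞) g ∧ ∀ n : S2, g (n : E3) = f n

/-- `F` admits a power-like singular expansion at `y` with coefficients `c`:
the family of exponents (the `a`'s with `c a ≠ 0`) is bounded below, with only
finitely many exponents below any given bound, the coefficients are smooth
functions on the sphere, and for every `N`, `F(y + r n) = Σ_{a ≤ N} r^a (c a)(n)
+ o(r^N)` as `r → 0⁺`, uniformly in `n ∈ S²`. -/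
structure HasSingExpansion (y : E3) (F : E3 → ℝ) (c : ℝ → S2 → ℝ) : Prop where
  smooth_coeffs : ∀ a : ℝ, SmoothSphereFn (c a)
  bddBelow : ∃ a₀ : ℝ, ∀ a : ℝ, a < a₀ → c a = 0
  finite_exponents : ∀ N : ℝ, {a : ℝ | a ≤ N ∧ c a ≠ 0}.Finite
  expansion : ∀ N : ℕ, ∀ ε > 0, ∃ δ > 0, ∀ r : ℝ, 0 < r → r < δ → ∀ n : S2,
    |F (y + r • (n : E3)) - ∑ᶠ (a : ℝ) (_ : a ≤ (N : ℝ)), r ^ a * c a n| ≤ ε * r ^ (N : ℝ)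

/-- The exponents of the singular expansion are integers. -/
def IntegerExponents (c : ℝ → S2 → ℝ) : Prop :=
  ∀ a : ℝ, c a ≠ 0 → ∃ k : ℤ, a = (k : ℝ)

/-- The Hadamard partie finie at the singular point, `(F)_y = (1/4π) ∫_{S²} f₀ dΩ`,
expressed in terms of the expansion coefficients `c` of `F`. -/
def pfAt (c : ℝ → S2 → ℝ) : ℝ :=
  (4 * π)⁻¹ * ∫ n : S2, c 0 n ∂dOmega

/-- `F` is smooth on a punctured neighbourhood of `y`. -/
def SmoothNearPunctured (y : E3) (F : E3 → ℝ) : Prop :=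
  ∃ U ∈ 𝓝 y, ContDiffOn ℝ (⊤ : ℕ∞) F (U \ {y})

/-- The quantity whose limit as `s → 0⁺` defines the Hadamard partie finie
`Pf_{s₁,s₂} ∫ F d³x`: the integral over `ℝ³` minus two balls of radius `s`,
plus the divergent subtractions built from the expansion coefficients `c` at `y₁`
and `d` at `y₂`. -/
def pfApprox (y₁ y₂ : E3) (s₁ s₂ : ℝ) (F : E3 → ℝ) (c d : ℝ → S2 → ℝ) (s : ℝ) : ℝ :=
  (∫ x in (Metric.closedBall y₁ s ∪ Metric.closedBall y₂ s)ᶜ, F x)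
    + (∑ᶠ (a : ℝ) (_ : a < -3), s ^ (a + 3) / (a + 3) * ∫ n : S2, c a n ∂dOmega)
    + Real.log (s / s₁) * (∫ n : S2, c (-3) n ∂dOmega)
    + (∑ᶠ (b : ℝ) (_ : b < -3), s ^ (b + 3) / (b + 3) * ∫ n : S2, d b n ∂dOmega)
    + Real.log (s / s₂) * (∫ n : S2, d (-3) n ∂dOmega)

/-- `Pf_{s₁,s₂} ∫ F d³x` exists and equals `L`. -/
def HasPfIntegral (y₁ y₂ : E3) (s₁ s₂ : ℝ) (F : E3 → ℝ) (c d : ℝ → S2 → ℝ) (L : ℝ) : Prop :=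
  Tendsto (pfApprox y₁ y₂ s₁ s₂ F c d) (𝓝[>] (0 : ℝ)) (𝓝 L)

/-- Membership in the class `𝓕`: smooth outside `{y₁, y₂}` and admitting singular
expansions at `y₁` (coefficients `c`) and `y₂` (coefficients `d`). -/
structure MemF (y₁ y₂ : E3) (F : E3 → ℝ) (c d : ℝ → S2 → ℝ) : Prop where
  smooth : ContDiffOn ℝ (⊤ : ℕ∞) F ({y₁, y₂}ᶜ : Set E3)
  exp₁ : HasSingExpansion y₁ F c
  exp₂ : HasSingExpansion y₂ F d

/-- The partial derivative `∂_i F` (as a plain function, defined outside the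
singularities via `fderiv`). -/
def pder (i : Fin 3) (F : E3 → ℝ) (x : E3) : ℝ :=
  fderiv ℝ F x (EuclideanSpace.single i 1)



/-- The closed annulus. -/
def Ann : Set E3 := {z | 1 ≤ ‖z‖ ∧ ‖z‖ ≤ 2}

/-- The open punctured ball. -/
def PB (y : E3) (R : ℝ) : Set E3 := Metric.ball y R \ {y}

lemma isOpen_PB (y : E3) (R : ℝ) : IsOpen (PB y R) :=
  Metric.isOpen_ball.sdiff isClosed_singleton

lemma isCompact_Ann : IsCompact Ann := by
  refine (isCompact_closedBall (0 : E3) 2).of_isClosed_subset ?_ ?_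
  · exact (isClosed_le continuous_const continuous_norm).inter
      (isClosed_le continuous_norm continuous_const)
  · intro z hz; simpa using hz.2

lemma ann_cs {ψ : E3 → ℝ} (hs : tsupport ψ ⊆ Ann) : HasCompactSupport ψ :=
  isCompact_Ann.of_isClosed_subset (isClosed_tsupport _) hs

lemma ann_cont {f ψ : E3 → ℝ} {W : Set E3} (hW : IsOpen W) (hAW : Ann ⊆ W)
    (hf : ContinuousOn f W) (hψ : Continuous ψ) (hs : tsupport ψ ⊆ Ann) :
    Continuous (fun z => f z * ψ z) := by
  rw [continuous_iff_continuousAt]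
  intro x
  by_cases hx : x ∈ tsupport ψ
  · exact (hf.continuousAt (hW.mem_nhds (hAW (hs hx)))).mul hψ.continuousAt
  · have : (fun z => f z * ψ z) =ᶠ[𝓝 x] fun _ => 0 := by
      filter_upwards [(notMem_tsupport_iff_eventuallyEq.1 hx)] with z hz
      simp [hz]
    exact (continuousAt_congr this).2 continuousAt_const

lemma ann_int {f ψ : E3 → ℝ} {W : Set E3} (hW : IsOpen W) (hAW : Ann ⊆ W)
    (hf : ContinuousOn f W) (hψ : Continuous ψ) (hs : tsupport ψ ⊆ Ann) :
    Integrable (fun z => f z * ψ z) := by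
  refine (ann_cont hW hAW hf hψ hs).integrable_of_hasCompactSupport ?_
  exact (ann_cs hs).mul_left

/-- The preimage of the punctured ball under dilation. -/
def WS (s R : ℝ) : Set E3 := {z | z ≠ 0 ∧ s * ‖z‖ < R}

lemma isOpen_WS (s R : ℝ) : IsOpen (WS s R) :=
  isOpen_ne.inter (isOpen_lt (f := fun z : E3 => s * ‖z‖) (by fun_prop) continuous_const)

lemma ann_WS {s R : ℝ} (hs : 0 < s) (hsR : 3 * s < R) : Ann ⊆ WS s R := by
  intro z hz
  refine ⟨?_, ?_⟩
  · rintro rfl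
    have := hz.1
    simp at this
    linarith
  · have := hz.2
    nlinarith

lemma WS_maps {s R : ℝ} (y : E3) (hs : 0 < s) :
    Set.MapsTo (fun z : E3 => y + s • z) (WS s R) (PB y R) := by
  intro z hz
  refine ⟨?_, ?_⟩
  · simpa [norm_smul, abs_of_pos hs] using hz.2
  · simpa [hs.ne'] using hz.1

lemma pow_unique (S : Finset ℝ) (d : ℝ → ℝ) (m : ℝ) (hS : ∀ a ∈ S, a ≤ m)
    (h : (fun s : ℝ => ∑ a ∈ S, s ^ a * d a) =o[𝓝[>] (0 : ℝ)] (fun s => s ^ m)) :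
    ∀ a ∈ S, d a = 0 := by
  classical
  by_contra hcon
  push Not at hcon
  obtain ⟨a1, ha1, hd1⟩ := hcon
  obtain ⟨b, hb, hbmin⟩ := (S.filter (fun a => d a ≠ 0)).exists_min_image id
    ⟨a1, by simp [ha1, hd1]⟩
  simp only [Finset.mem_filter, id, and_imp] at hb hbmin
  have hpos : ∀ᶠ s : ℝ in 𝓝[>] (0 : ℝ), 0 < s := self_mem_nhdsWithin
  have hp0 : ∀ e : ℝ, 0 < e → Tendsto (fun s : ℝ => s ^ e) (𝓝[>] (0 : ℝ)) (𝓝 0) := by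
    intro e he
    have := (Real.continuousAt_rpow_const 0 e (Or.inr he.le)).tendsto
    rw [Real.zero_rpow he.ne'] at this
    exact this.mono_left nhdsWithin_le_nhds
  have h1 : Tendsto (fun s : ℝ => ∑ a ∈ S, s ^ (a - b) * d a) (𝓝[>] (0 : ℝ))
      (𝓝 (∑ a ∈ S, if a = b then d b else 0)) := by
    refine tendsto_finsetSum _ fun a ha => ?_
    by_cases hab : a = b
    · subst hab
      simp
    · simp only [hab, if_false]
      by_cases hda : d a = 0
      · simp [hda]
      · have : b < a := lt_of_le_of_ne (hbmin a ha hda) (Ne.symm hab)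
        simpa using (hp0 (a - b) (by linarith)).mul_const (d a)
  have h2 : (fun s : ℝ => ∑ a ∈ S, s ^ (a - b) * d a) =o[𝓝[>] (0 : ℝ)] (fun _ => (1 : ℝ)) := by
    have h3 := (isBigO_refl (fun s : ℝ => s ^ (-b)) (𝓝[>] (0 : ℝ))).mul_isLittleO h
    refine (h3.congr' ?_ (EventuallyEq.refl _ _)).trans_isBigO ?_
    · filter_upwards [hpos] with s hs
      rw [Finset.mul_sum]
      refine Finset.sum_congr rfl fun a _ => ?_
      rw [sub_eq_add_neg, Real.rpow_add hs]; ring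
    · refine IsBigO.of_bound 1 ?_
      have : ∀ᶠ s : ℝ in 𝓝[>] (0 : ℝ), s < 1 :=
        nhdsWithin_le_nhds (Iio_mem_nhds one_pos)
      filter_upwards [hpos, this] with s hs hs1
      rw [← Real.rpow_add hs, Real.norm_of_nonneg (Real.rpow_nonneg hs.le _)]
      simpa using Real.rpow_le_one hs.le hs1.le (by linarith [hS b hb.1])
  rw [isLittleO_one_iff] at h2
  have := tendsto_nhds_unique h1 h2
  simp [hb.1] at this
  exact hb.2 this

lemma pairing {y : E3} {K : E3 → ℝ} {q : ℝ → S2 → ℝ} (hK : HasSingExpansion y K q)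
    {R : ℝ} (hR : 0 < R) (hc : ContinuousOn K (PB y R))
    {g : ℝ → E3 → ℝ} (hg : ∀ a, Continuous (g a)) (hgq : ∀ a, ∀ n : S2, g a n = q a n)
    {ψ : E3 → ℝ} (hψ : Continuous ψ) (hs : tsupport ψ ⊆ Ann) (N : ℕ) :
    (fun s : ℝ => (∫ z, K (y + s • z) * ψ z) - ∑ a ∈ (hK.finite_exponents N).toFinset,
      s ^ a * ∫ z, (‖z‖ ^ a * g a (‖z‖⁻¹ • z)) * ψ z) =o[𝓝[>] (0 : ℝ)]
      (fun s => s ^ (N : ℝ)) := by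
  set T := (hK.finite_exponents N).toFinset with hT
  have hTm : ∀ a, a ∈ T ↔ a ≤ N ∧ q a ≠ 0 := by simp [hT]
  have hW0 : Ann ⊆ {z : E3 | z ≠ 0} := fun z hz => by
    rintro rfl
    have := hz.1
    simp at this
    linarith
  have hi1 : ∀ a, Integrable (fun z : E3 => (‖z‖ ^ a * g a (‖z‖⁻¹ • z)) * ψ z) := by
    intro a
    refine ann_int isOpen_ne hW0 ?_ hψ hs
    have hn : ∀ z ∈ {z : E3 | z ≠ 0}, ‖z‖ ≠ 0 := fun z hz => norm_ne_zero_iff.2 hz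
    refine ContinuousOn.mul ?_ ?_
    · exact continuous_norm.continuousOn.rpow_const fun z hz => Or.inl (hn z hz)
    · exact (hg a).comp_continuousOn
        ((continuous_norm.continuousOn.inv₀ hn).smul continuousOn_id)
  have hψi : Integrable (fun z => |ψ z|) :=
    (hψ.integrable_of_hasCompactSupport (ann_cs hs)).abs
  have hM : 0 ≤ ∫ z, |ψ z| := integral_nonneg fun z => abs_nonneg _
  set M := ∫ z, |ψ z|
  rw [isLittleO_iff]
  intro ε hε
  have hD : 0 < (2 : ℝ) ^ N * M + 1 := by positivity
  obtain ⟨δ, hδ, hexp⟩ := hK.expansion N (ε / (2 ^ N * M + 1)) (by positivity)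
  have e1 : ∀ᶠ s : ℝ in 𝓝[>] (0 : ℝ), 0 < s := self_mem_nhdsWithin
  have e2 : ∀ᶠ s : ℝ in 𝓝[>] (0 : ℝ), s < min (δ / 3) (R / 3) :=
    nhdsWithin_le_nhds (Iio_mem_nhds (by positivity))
  filter_upwards [e1, e2] with s hs0 hs1
  rw [lt_min_iff] at hs1
  have hi0 : Integrable (fun z : E3 => K (y + s • z) * ψ z) := by
    refine ann_int (isOpen_WS s R) (ann_WS hs0 (by linarith)) ?_ hψ hs
    exact hc.comp (by fun_prop) (WS_maps y hs0)
  have heq : (∫ z, K (y + s • z) * ψ z) - ∑ a ∈ T,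
      s ^ a * ∫ z, (‖z‖ ^ a * g a (‖z‖⁻¹ • z)) * ψ z =
      ∫ z, (K (y + s • z) * ψ z - ∑ a ∈ T, s ^ a * ((‖z‖ ^ a * g a (‖z‖⁻¹ • z)) * ψ z)) := by
    rw [integral_sub hi0 (integrable_finsetSum _ fun a _ => (hi1 a).const_mul _),
      integral_finsetSum _ fun a _ => (hi1 a).const_mul _]
    simp_rw [integral_const_mul]
  rw [heq]
  have hbound : ‖∫ z, (K (y + s • z) * ψ z - ∑ a ∈ T,
      s ^ a * ((‖z‖ ^ a * g a (‖z‖⁻¹ • z)) * ψ z))‖ ≤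
      ∫ z, (ε / (2 ^ N * M + 1) * (2 * s) ^ N) * |ψ z| := by
    refine norm_integral_le_of_norm_le (hψi.const_mul _) (Eventually.of_forall fun z => ?_)
    by_cases hz : z ∈ Ann
    · have hz0 : ‖z‖ ≠ 0 := norm_ne_zero_iff.2 (hW0 hz)
      have hzp : 0 < ‖z‖ := norm_pos_iff.2 (hW0 hz)
      set n : S2 := ⟨‖z‖⁻¹ • z, by simp [norm_smul, hz0]⟩ with hn
      have hsz : s • z = (s * ‖z‖) • (n : E3) := by
        simp [hn, smul_smul, hz0]
      have h1 := hexp (s * ‖z‖) (by positivity) (by nlinarith [hz.2]) n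
      have hfs : ∑ᶠ (a : ℝ) (_ : a ≤ (N : ℝ)), (s * ‖z‖) ^ a * q a n
          = ∑ a ∈ T, (s * ‖z‖) ^ a * q a n := by
        refine finsum_mem_eq_sum_of_inter_support_eq (s := {a : ℝ | a ≤ (N : ℝ)}) _ ?_
        ext a
        simp only [Set.mem_inter_iff, Set.mem_ofPred_eq, Function.mem_support, Finset.mem_coe, hTm]
        constructor
        · rintro ⟨h1, h2⟩
          refine ⟨⟨h1, ?_⟩, h2⟩
          intro h
          simp [h] at h2
        · rintro ⟨h1, h2⟩
          exact ⟨h1.1, h2⟩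
      rw [hfs, ← hsz] at h1
      have h2 : K (y + s • z) * ψ z - ∑ a ∈ T, s ^ a * ((‖z‖ ^ a * g a (‖z‖⁻¹ • z)) * ψ z)
          = (K (y + s • z) - ∑ a ∈ T, (s * ‖z‖) ^ a * q a n) * ψ z := by
        rw [sub_mul, Finset.sum_mul]
        congr 1
        refine Finset.sum_congr rfl fun a _ => ?_
        rw [Real.mul_rpow hs0.le hzp.le, ← hgq a n]
        simp only [hn]
        ring
      rw [h2, norm_mul, Real.norm_eq_abs, Real.norm_eq_abs]
      refine mul_le_mul_of_nonneg_right (h1.trans ?_) (abs_nonneg _)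
      rw [Real.rpow_natCast]
      have : s * ‖z‖ ≤ 2 * s := by nlinarith [hz.2]
      gcongr
    · have : ψ z = 0 := image_eq_zero_of_notMem_tsupport fun h => hz (hs h)
      simp [this]
  refine hbound.trans ?_
  rw [integral_const_mul, Real.rpow_natCast, Real.norm_of_nonneg (by positivity), mul_pow]
  change ε / (2 ^ N * M + 1) * (2 ^ N * s ^ N) * M ≤ ε * s ^ N
  have h3 : ε / (2 ^ N * M + 1) * (2 ^ N * s ^ N) * M
    = ε * s ^ N * ((2 ^ N * M) / (2 ^ N * M + 1)) := by field_simp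
  rw [h3]
  refine mul_le_of_le_one_right (by positivity) ?_
  rw [div_le_one hD]
  linarith

lemma compare {y : E3} {K F : E3 → ℝ} {q c : ℝ → S2 → ℝ} (hK : HasSingExpansion y K q)
    (hF : HasSingExpansion y F c)
    {R : ℝ} (hR : 0 < R) (hKc : ContinuousOn K (PB y R)) (hFc : ContinuousOn F (PB y R))
    {g : ℝ → E3 → ℝ} (hg : ∀ a, Continuous (g a)) (hgq : ∀ a, ∀ n : S2, g a n = q a n)
    {f : ℝ → E3 → ℝ} (hf : ∀ a, Continuous (f a)) (hfc : ∀ a, ∀ n : S2, f a n = c a n)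
    {ψ φ : E3 → ℝ} (hψ : Continuous ψ) (hs : tsupport ψ ⊆ Ann)
    (hφ : Continuous φ) (hs' : tsupport φ ⊆ Ann) (m : ℕ)
    (h : ∀ s : ℝ, 0 < s → 3 * s < R →
      s ^ m * (∫ z, K (y + s • z) * ψ z) = ∫ z, F (y + s • z) * φ z) :
    (∫ z, g 0 (‖z‖⁻¹ • z) * ψ z) = ∫ z, (‖z‖ ^ m * f m (‖z‖⁻¹ • z)) * φ z := by
  classical
  have p1 := pairing hK hR hKc hg hgq hψ hs 0
  have p2 := pairing hF hR hFc hf hfc hφ hs' m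
  set T1 := (hK.finite_exponents ((0 : ℕ) : ℝ)).toFinset with hT1
  set T2 := (hF.finite_exponents (m : ℝ)).toFinset with hT2
  set Q : ℝ → ℝ := fun a => ∫ z, (‖z‖ ^ a * g a (‖z‖⁻¹ • z)) * ψ z with hQ
  set C : ℝ → ℝ := fun a => ∫ z, (‖z‖ ^ a * f a (‖z‖⁻¹ • z)) * φ z with hC
  have ann0 : ∀ z : E3, z ∈ Ann → ‖z‖ ≠ 0 := fun z hz h0 => by
    have := hz.1
    rw [h0] at this
    linarith
  have hQ0 : ∀ a ∉ T1, a ≤ 0 → Q a = 0 := by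
    intro a ha ha0
    have hqa : q a = 0 := by
      by_contra hne
      exact ha (by simp [hT1, hne, ha0])
    refine integral_eq_zero_of_ae (Eventually.of_forall fun z => ?_)
    by_cases hz : z ∈ Ann
    · have := hgq a ⟨‖z‖⁻¹ • z, by simp [norm_smul, ann0 z hz]⟩
      simp only at this
      simp [this, hqa]
    · have : ψ z = 0 := image_eq_zero_of_notMem_tsupport fun h => hz (hs h)
      simp [this]
  have hC0 : ∀ a ∉ T2, a ≤ m → C a = 0 := by
    intro a ha ha0
    have hqa : c a = 0 := by
      by_contra hne
      exact ha (by simp [hT2, hne, ha0])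
    refine integral_eq_zero_of_ae (Eventually.of_forall fun z => ?_)
    by_cases hz : z ∈ Ann
    · have := hfc a ⟨‖z‖⁻¹ • z, by simp [norm_smul, ann0 z hz]⟩
      simp only at this
      simp [this, hqa]
    · have : φ z = 0 := image_eq_zero_of_notMem_tsupport fun h => hz (hs' h)
      simp [this]
  set S : Finset ℝ := insert (m : ℝ) (T1.image (fun a => a + m) ∪ T2) with hS
  have hSle : ∀ a ∈ S, a ≤ (m : ℝ) := by
    intro a ha
    simp only [hS, Finset.mem_insert, Finset.mem_union, Finset.mem_image, hT1, hT2,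
      Set.Finite.mem_toFinset, Set.mem_ofPred_eq] at ha
    rcases ha with rfl | ⟨b, hb, rfl⟩ | hb
    · exact le_rfl
    · have := hb.1
      simp at this
      linarith
    · exact hb.1
  have key : (fun s : ℝ => ∑ a ∈ S, s ^ a * (C a - Q (a - m))) =o[𝓝[>] (0 : ℝ)]
      (fun s => s ^ (m : ℝ)) := by
    have p3 := ((isBigO_refl (fun s : ℝ => s ^ (m : ℝ)) (𝓝[>] (0 : ℝ))).mul_isLittleO p1)
    have p4 : (fun s : ℝ => s ^ (m : ℝ) * ((∫ z, K (y + s • z) * ψ z) - ∑ a ∈ T1, s ^ a * Q a))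
        =o[𝓝[>] (0 : ℝ)] (fun s => s ^ (m : ℝ)) := by
      simpa using p3
    have p5 := p4.sub p2
    refine p5.congr' ?_ (EventuallyEq.refl _ _)
    have e1 : ∀ᶠ s : ℝ in 𝓝[>] (0 : ℝ), 0 < s := self_mem_nhdsWithin
    have e2 : ∀ᶠ s : ℝ in 𝓝[>] (0 : ℝ), s < R / 3 :=
      nhdsWithin_le_nhds (Iio_mem_nhds (by positivity))
    filter_upwards [e1, e2] with s hs0 hs1
    have hh := h s hs0 (by linarith)
    have hsumC : ∑ a ∈ S, s ^ a * C a = ∑ a ∈ T2, s ^ a * C a := by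
      symm
      refine Finset.sum_subset (fun a ha => by simp [hS, ha]) fun a ha ha2 => ?_
      rw [hC0 a ha2 (hSle a ha), mul_zero]
    have hsumQ : ∑ a ∈ S, s ^ a * Q (a - m) = s ^ (m : ℝ) * ∑ a ∈ T1, s ^ a * Q a := by
      have : s ^ (m : ℝ) * ∑ a ∈ T1, s ^ a * Q a
          = ∑ a ∈ T1.image (fun a => a + (m : ℝ)), s ^ a * Q (a - m) := by
        rw [Finset.sum_image (by intro a _ b _ hab; simpa using hab), Finset.mul_sum]
        refine Finset.sum_congr rfl fun a _ => ?_
        rw [Real.rpow_add hs0]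
        simp only [add_sub_cancel_right]
        ring
      rw [this]
      symm
      refine Finset.sum_subset (fun a ha => ?_) fun a ha ha2 => ?_
      · simp only [hS, Finset.mem_insert, Finset.mem_union]
        exact Or.inr (Or.inl ha)
      · rw [hQ0 (a - m) ?_ (by linarith [hSle a ha]), mul_zero]
        intro hmem
        exact ha2 (Finset.mem_image.2 ⟨a - m, hmem, by ring⟩)
    simp_rw [mul_sub, Finset.sum_sub_distrib]
    rw [hsumC, hsumQ, ← hh, Real.rpow_natCast]
    ring
  have := pow_unique S (fun a => C a - Q (a - m)) m hSle key m (by simp [hS])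
  simp only [sub_self] at this
  have hfin : Q 0 = C m := by linarith
  simpa [hQ, hC] using hfin

lemma pder_contDiffOn {F : E3 → ℝ} {W : Set E3} (hW : IsOpen W)
    (hF : ContDiffOn ℝ (⊤ : ℕ∞) F W) (i : Fin 3) : ContDiffOn ℝ (⊤ : ℕ∞) (pder i F) W := by
  have h : ContDiffOn ℝ (⊤ : ℕ∞) (fderiv ℝ F) W := hF.fderiv_of_isOpen hW (by simp)
  exact h.clm_apply contDiffOn_const

lemma pder_contDiff {F : E3 → ℝ} (hF : ContDiff ℝ (⊤ : ℕ∞) F) (i : Fin 3) :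
    ContDiff ℝ (⊤ : ℕ∞) (pder i F) := by
  rw [← contDiffOn_univ] at hF ⊢
  exact pder_contDiffOn isOpen_univ hF i

lemma pder_tsupport {ψ : E3 → ℝ} (hs : tsupport ψ ⊆ Ann) (i : Fin 3) :
    tsupport (pder i ψ) ⊆ Ann := by
  refine (closure_mono ?_).trans ((tsupport_fderiv_subset ℝ (f := ψ)).trans hs)
  intro z hz
  simp only [Function.mem_support] at hz ⊢
  intro h
  apply hz
  simp [pder, h]

lemma ibp {f ψ : E3 → ℝ} {W : Set E3} (hW : IsOpen W) (hAW : Ann ⊆ W)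
    (hf : ContDiffOn ℝ (⊤ : ℕ∞) f W) (hψ : ContDiff ℝ (⊤ : ℕ∞) ψ) (hs : tsupport ψ ⊆ Ann)
    (i : Fin 3) :
    ∫ z, pder i f z * ψ z = - ∫ z, f z * pder i ψ z := by
  have := integral_mul_fderiv_eq_neg_fderiv_mul_of_integrable (μ := (volume : Measure E3))
    (f := f) (g := ψ) (v := EuclideanSpace.single i 1)
    (ann_int hW hAW (pder_contDiffOn hW hf i).continuousOn hψ.continuous hs)
    (ann_int hW hAW hf.continuousOn (pder_contDiff hψ i).continuous (pder_tsupport hs i))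
    (ann_int hW hAW hf.continuousOn hψ.continuous hs)
    (fun x hx => (hf.contDiffAt (hW.mem_nhds (hAW (hs hx)))).differentiableAt (by simp))
    (fun x _ => hψ.differentiable (by simp) x)
  simp only [pder]
  rw [this, neg_neg]

lemma pder_scale (F : E3 → ℝ) (y : E3) (s : ℝ) (i : Fin 3) (z : E3) :
    pder i (fun z => F (y + s • z)) z = s * pder i F (y + s • z) := by
  have h : fderiv ℝ (fun z => F (y + s • z)) z = s • fderiv ℝ F (y + s • z) := by
    have := fderiv_comp_smul (𝕜 := ℝ) (f := fun x => F (y + x)) (x := z) s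
    rw [fderiv_comp_add_left] at this
    exact this
  simp [pder, h]

lemma ibp2 {F : E3 → ℝ} {y : E3} {R : ℝ} (hF : ContDiffOn ℝ (⊤ : ℕ∞) F (PB y R))
    {ψ : E3 → ℝ} (hψ : ContDiff ℝ (⊤ : ℕ∞) ψ) (hs : tsupport ψ ⊆ Ann) (i j : Fin 3)
    {s : ℝ} (hs0 : 0 < s) (hsR : 3 * s < R) :
    s ^ 2 * ∫ z, pder i (pder j F) (y + s • z) * ψ z
      = ∫ z, F (y + s • z) * pder j (pder i ψ) z := by
  have hc : ContDiffOn ℝ (⊤ : ℕ∞) (fun z => F (y + s • z)) (WS s R) :=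
    hF.comp (by fun_prop) (WS_maps y hs0)
  have h1 := ibp (isOpen_WS s R) (ann_WS hs0 hsR) (pder_contDiffOn (isOpen_WS s R) hc j) hψ hs i
  have h2 := ibp (isOpen_WS s R) (ann_WS hs0 hsR) hc (pder_contDiff hψ i) (pder_tsupport hs i) j
  rw [h2, neg_neg] at h1
  rw [← h1, ← integral_const_mul]
  congr 1
  ext z
  have e : pder j (fun z => F (y + s • z)) = fun z => s * pder j F (y + s • z) := by
    ext z; exact pder_scale F y s j z
  rw [e, pder_scale (fun x => s * pder j F x) y s i z]
  have : pder i (fun x => s * pder j F x) (y + s • z) = s * pder i (pder j F) (y + s • z) := by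
    have h := congrFun (fderiv_const_smul_field (𝕜 := ℝ) (f := pder j F) s) (y + s • z)
    have h' : fderiv ℝ (fun x => s * pder j F x) (y + s • z) =
      s • fderiv ℝ (pder j F) (y + s • z) := h
    change (fderiv ℝ (fun x => s * pder j F x) (y + s • z)) (EuclideanSpace.single i 1) = _
    rw [h']
    rfl
  rw [this]; ring

lemma pder_radial {θ : ℝ → ℝ} (hθ : ContDiff ℝ (⊤ : ℕ∞) θ) (i : Fin 3) (z : E3) :
    pder i (fun z => θ (‖z‖ ^ 2)) z = 2 * z i * deriv θ (‖z‖ ^ 2) := by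
  have h1 : HasFDerivAt (fun z : E3 => ‖z‖ ^ 2) (2 • innerSL ℝ z) z :=
    (hasStrictFDerivAt_norm_sq z).hasFDerivAt
  have h2 : HasDerivAt θ (deriv θ (‖z‖ ^ 2)) (‖z‖ ^ 2) :=
    (hθ.differentiable (by simp) _).hasDerivAt
  have h3 := h2.comp_hasFDerivAt z h1
  have h4 : fderiv ℝ (fun z : E3 => θ (‖z‖ ^ 2)) z = _ := h3.fderiv
  rw [pder, h4]
  simp [EuclideanSpace.inner_single_right]
  ring

lemma deriv_smooth {θ : ℝ → ℝ} (hθ : ContDiff ℝ (⊤ : ℕ∞) θ) :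
    ContDiff ℝ (⊤ : ℕ∞) (deriv θ) := (contDiff_infty_iff_deriv.1 hθ).2

lemma pder2_radial {θ : ℝ → ℝ} (hθ : ContDiff ℝ (⊤ : ℕ∞) θ) (i j : Fin 3) (z : E3) :
    pder j (pder i (fun z => θ (‖z‖ ^ 2))) z =
      (if i = j then 1 else 0) * (2 * deriv θ (‖z‖ ^ 2))
        + z i * z j * (4 * deriv (deriv θ) (‖z‖ ^ 2)) := by
  have e : pder i (fun z => θ (‖z‖ ^ 2)) = fun z => (2 * z i) * deriv θ (‖z‖ ^ 2) := by
    ext z; exact pder_radial hθ i z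
  have hd := deriv_smooth hθ
  have hr : DifferentiableAt ℝ (fun z : E3 => deriv θ (‖z‖ ^ 2)) z := by
    have : ContDiff ℝ (⊤ : ℕ∞) (fun z : E3 => deriv θ (‖z‖ ^ 2)) := hd.comp (contDiff_norm_sq ℝ)
    exact this.differentiable (by simp) z
  have hl : HasFDerivAt (fun z : E3 => 2 * z i)
      ((2 : ℝ) • (EuclideanSpace.proj i : E3 →L[ℝ] ℝ)) z :=
    ((EuclideanSpace.proj i : E3 →L[ℝ] ℝ).hasFDerivAt).const_mul 2
  have h := (hl.mul hr.hasFDerivAt).fderiv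
  have h5 := pder_radial hd j z
  rw [pder] at h5
  rw [e, pder]
  have h' : fderiv ℝ (fun z : E3 => (2 * z i) * deriv θ (‖z‖ ^ 2)) z = _ := h
  rw [h']
  simp [h5, smul_eq_mul]
  split_ifs <;> ring

lemma polar (g : S2 → ℝ) (G : E3 → ℝ) (h : ℝ → ℝ)
    (hG : ∀ (n : S2) (r : ℝ), 0 < r → G (r • (n : E3)) = g n * h r) :
    ∫ z, G z = (∫ n, g n ∂dOmega) * ∫ r in Set.Ioi (0 : ℝ), r ^ 2 * h r := by
  have hdim : Module.finrank ℝ E3 - 1 = 2 := by simp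
  calc
    ∫ z, G z = ∫ x : ({(0 : E3)}ᶜ : Set E3), G x.1 ∂((volume : Measure E3).comap (↑)) := by
      rw [integral_subtype_comap (measurableSet_singleton _).compl G,
        restrict_compl_singleton]
    _ = ∫ x, g x.1 * h x.2 ∂(volume : Measure E3).toSphere.prod
          (.volumeIoiPow (Module.finrank ℝ E3 - 1)) := by
      rw [← (volume : Measure E3).measurePreserving_homeomorphUnitSphereProd.integral_comp
        (Homeomorph.measurableEmbedding _)]
      congr 1
      ext x
      have hx : ‖x.1‖ ≠ 0 := norm_ne_zero_iff.2 x.2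
      have := hG (homeomorphUnitSphereProd E3 x).1 ‖x.1‖ (norm_pos_iff.2 x.2)
      simp only [homeomorphUnitSphereProd_apply_snd_coe]
      rw [← this]
      simp [smul_smul, hx]
    _ = (∫ n, g n ∂dOmega) * ∫ x : Set.Ioi (0 : ℝ), h x
          ∂.volumeIoiPow (Module.finrank ℝ E3 - 1) :=
      integral_prod_mul (μ := (volume : Measure E3).toSphere) g (fun x : Set.Ioi (0 : ℝ) => h x)
    _ = _ := by
      rw [hdim]
      congr 1
      simp only [Measure.volumeIoiPow, ENNReal.ofReal]
      rw [integral_withDensity_eq_integral_smul,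
        integral_subtype_comap measurableSet_Ioi fun a => Real.toNNReal (a ^ 2) • h a,
        setIntegral_congr_fun measurableSet_Ioi fun x hx => ?_]
      · simp only [NNReal.smul_def]
        rw [Real.coe_toNNReal _ (by positivity)]
        rfl
      · exact (measurable_subtype_coe.pow_const _).real_toNNReal

/-- Radial profiles: smooth with support in `[1,4]`. -/
structure Prof (θ : ℝ → ℝ) : Prop where
  smooth : ContDiff ℝ (⊤ : ℕ∞) θ
  supp : tsupport θ ⊆ Set.Icc 1 4

lemma Prof.deriv {θ : ℝ → ℝ} (h : Prof θ) : Prof (deriv θ) :=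
  ⟨deriv_smooth h.smooth, (closure_minimal (support_deriv_subset) (isClosed_tsupport _)).trans
    h.supp⟩

lemma Prof.mul {θ p : ℝ → ℝ} (h : Prof θ) (hp : ContDiff ℝ (⊤ : ℕ∞) p) :
    Prof (fun t => p t * θ t) :=
  ⟨hp.mul h.smooth, (closure_mono (fun x hx => by
    simp only [Function.mem_support] at hx ⊢
    exact right_ne_zero_of_mul hx)).trans h.supp⟩

lemma Prof.ann {θ : ℝ → ℝ} (h : Prof θ) : tsupport (fun z : E3 => θ (‖z‖ ^ 2)) ⊆ Ann := by
  refine closure_minimal ?_ isCompact_Ann.isClosed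
  intro z hz
  have := h.supp (subset_tsupport θ hz)
  constructor
  · nlinarith [this.1, norm_nonneg z]
  · nlinarith [this.2, norm_nonneg z]

lemma Prof.comp_smooth {θ : ℝ → ℝ} (h : Prof θ) :
    ContDiff ℝ (⊤ : ℕ∞) (fun z : E3 => θ (‖z‖ ^ 2)) := h.smooth.comp (contDiff_norm_sq ℝ)

lemma Prof.hcs {θ p : ℝ → ℝ} (h : Prof θ) :
    HasCompactSupport (fun r : ℝ => p r * θ (r ^ 2)) := by
  refine HasCompactSupport.of_support_subset_isCompact (isCompact_Icc (a := (-2 : ℝ)) (b := 2)) ?_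
  intro r hr
  simp only [Function.mem_support] at hr
  have := h.supp (subset_tsupport θ (right_ne_zero_of_mul hr))
  constructor <;> nlinarith [this.2]

lemma Prof.int {θ p : ℝ → ℝ} (h : Prof θ) (hp : Continuous p) :
    Integrable (fun r : ℝ => p r * θ (r ^ 2)) :=
  (hp.mul (h.smooth.continuous.comp (by fun_prop))).integrable_of_hasCompactSupport h.hcs

/-- One-dimensional integration by parts for radial profiles. -/
lemma Prof.ibp {θ : ℝ → ℝ} (h : Prof θ) (k : ℕ) :
    ∫ r in Set.Ioi (0 : ℝ), 2 * r ^ (k + 2) * _root_.deriv θ (r ^ 2)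
      = - ((k + 1) * ∫ r in Set.Ioi (0 : ℝ), r ^ k * θ (r ^ 2)) := by
  have hc : ContDiff ℝ 1 (fun r : ℝ => r ^ (k + 1) * θ (r ^ 2)) :=
    (contDiff_id.pow _).mul ((h.smooth.of_le (by simp)).comp (contDiff_id.pow 2))
  have h1 := HasCompactSupport.integral_Ioi_deriv_eq hc h.hcs 0
  have hd : _root_.deriv (fun r : ℝ => r ^ (k + 1) * θ (r ^ 2)) = fun r =>
      2 * r ^ (k + 2) * _root_.deriv θ (r ^ 2) + (k + 1) * (r ^ k * θ (r ^ 2)) := by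
    ext r
    have a1 : HasDerivAt (fun r : ℝ => r ^ (k + 1)) _ r := hasDerivAt_pow (k + 1) r
    have a2 : HasDerivAt (fun r : ℝ => r ^ 2) _ r := hasDerivAt_pow 2 r
    have a3 := ((h.smooth.differentiable (by simp) (r ^ 2)).hasDerivAt).comp r a2
    have a4 := (a1.mul a3).deriv
    have a5 : _root_.deriv (fun r : ℝ => r ^ (k + 1) * θ (r ^ 2)) r = _ := a4
    rw [a5]
    simp
    ring
  rw [hd, integral_add, integral_const_mul] at h1
  · simp at h1
    linarith
  · exact (h.deriv.int (p := fun r => 2 * r ^ (k + 2)) (by fun_prop)).integrableOn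
  · exact ((h.int (p := fun r => r ^ k) (by fun_prop)).const_mul _).integrableOn

lemma exists_prof : ∃ θ : ℝ → ℝ, Prof θ ∧ 0 < ∫ r in Set.Ioi (0 : ℝ), r ^ 2 * θ (r ^ 2) := by
  let b : ContDiffBump (5 / 2 : ℝ) := ⟨1 / 2, 1, by norm_num, by norm_num⟩
  have hP : Prof b := by
    refine ⟨b.contDiff, ?_⟩
    rw [b.tsupport_eq, Real.closedBall_eq_Icc]
    refine Set.Icc_subset_Icc ?_ ?_ <;> norm_num [b]
  refine ⟨b, hP, ?_⟩
  have hcont : Continuous (fun r : ℝ => r ^ 2 * b (r ^ 2)) :=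
    (continuous_pow 2).mul (b.continuous.comp (continuous_pow 2))
  rw [setIntegral_pos_iff_support_of_nonneg_ae
    (Eventually.of_forall fun r => mul_nonneg (sq_nonneg _) b.nonneg)
    (hP.int (p := fun r => r ^ 2) (by fun_prop)).integrableOn]
  refine IsOpen.measure_pos _ (hcont.isOpen_support.inter isOpen_Ioi) ⟨√(5/2), ?_, ?_⟩
  · have h2 : √(5/2 : ℝ) ^ 2 = 5 / 2 := Real.sq_sqrt (by norm_num)
    simp only [Function.mem_support, h2]
    have : b (5/2) = 1 := b.one_of_mem_closedBall (Metric.mem_closedBall_self b.rIn_pos.le)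
    rw [this]
    norm_num
  · exact Real.sqrt_pos.2 (by norm_num)

instance : IsFiniteMeasure dOmega := by unfold dOmega; infer_instance

lemma sphere_int {g : S2 → ℝ} (hg : Continuous g) : Integrable g dOmega :=
  hg.integrable_of_hasCompactSupport (HasCompactSupport.of_compactSpace g)

lemma ann_ne : Ann ⊆ {z : E3 | z ≠ 0} := fun z hz => by
  rintro rfl
  have := hz.1
  simp at this
  linarith

lemma hom_cont {f : E3 → ℝ} (hf : Continuous f) (m : ℕ) :
    ContinuousOn (fun z : E3 => ‖z‖ ^ m * f (‖z‖⁻¹ • z)) {z : E3 | z ≠ 0} := by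
  have hn : ∀ z ∈ {z : E3 | z ≠ 0}, ‖z‖ ≠ 0 := fun z hz => norm_ne_zero_iff.2 hz
  exact (continuous_norm.pow m).continuousOn.mul (hf.comp_continuousOn
    ((continuous_norm.continuousOn.inv₀ hn).smul continuousOn_id))

lemma mul_ann {p ψ : E3 → ℝ} (hs : tsupport ψ ⊆ Ann) : tsupport (fun z => p z * ψ z) ⊆ Ann :=
  (closure_mono (fun x hx => by
    simp only [Function.mem_support] at hx ⊢
    exact right_ne_zero_of_mul hx)).trans hs

lemma coe_unit (n : S2) {r : ℝ} (hr : 0 < r) : ‖r • (n : E3)‖⁻¹ • (r • (n : E3)) = n := by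
  have : ‖(n : E3)‖ = 1 := by simp
  rw [norm_smul, this, Real.norm_of_nonneg hr.le, smul_smul]
  simp [hr.ne']

lemma norm_unit (n : S2) {r : ℝ} (hr : 0 < r) : ‖r • (n : E3)‖ = r := by
  have : ‖(n : E3)‖ = 1 := by simp
  rw [norm_smul, this, Real.norm_of_nonneg hr.le, mul_one]

lemma lhs_eval {θ : ℝ → ℝ} {g : E3 → ℝ} {q : S2 → ℝ} (hgq : ∀ n : S2, g n = q n) :
    ∫ z, g (‖z‖⁻¹ • z) * θ (‖z‖ ^ 2)
      = (∫ n, q n ∂dOmega) * ∫ r in Set.Ioi (0 : ℝ), r ^ 2 * θ (r ^ 2) := by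
  refine polar q _ (fun r => θ (r ^ 2)) fun n r hr => ?_
  rw [coe_unit n hr, norm_unit n hr, hgq]

lemma rhs_eval {θ : ℝ → ℝ} (hθ : Prof θ) {f : E3 → ℝ} (hf : Continuous f) {c : S2 → ℝ}
    (hfc : ∀ n : S2, f n = c n) (m : ℕ) (i j : Fin 3) :
    ∫ z, (‖z‖ ^ m * f (‖z‖⁻¹ • z)) * pder j (pder i (fun z => θ (‖z‖ ^ 2))) z
      = (m + 1) * (∫ r in Set.Ioi (0 : ℝ), r ^ m * θ (r ^ 2)) *
        ((m + 3) * (∫ n, (n : E3) i * (n : E3) j * c n ∂dOmega)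
          - (if i = j then 1 else 0) * ∫ n, c n ∂dOmega) := by
  have hd := hθ.deriv
  have hdd := hd.deriv
  have i1 := ann_int isOpen_ne ann_ne (hom_cont hf m)
    (ψ := fun z : E3 => ((if i = j then 1 else 0) * 2) * deriv θ (‖z‖ ^ 2))
    (hd.comp_smooth.continuous.const_mul _) (mul_ann hd.ann)
  have i2 := ann_int isOpen_ne ann_ne (hom_cont hf m)
    (ψ := fun z : E3 => (z i * z j * 4) * deriv (deriv θ) (‖z‖ ^ 2))
    (Continuous.mul (by fun_prop) hdd.comp_smooth.continuous) (mul_ann hdd.ann)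
  have e : ∀ z : E3, (‖z‖ ^ m * f (‖z‖⁻¹ • z)) * pder j (pder i (fun z => θ (‖z‖ ^ 2))) z
      = (‖z‖ ^ m * f (‖z‖⁻¹ • z)) * (((if i = j then 1 else 0) * 2) * deriv θ (‖z‖ ^ 2))
      + (‖z‖ ^ m * f (‖z‖⁻¹ • z)) * ((z i * z j * 4) * deriv (deriv θ) (‖z‖ ^ 2)) := by
    intro z
    rw [pder2_radial hθ.smooth]
    ring
  simp_rw [e]
  rw [integral_add i1 i2]
  rw [polar (fun n => (if i = j then 1 else 0) * c n) _ (fun r => r ^ m * (2 * deriv θ (r ^ 2)))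
    (fun n r hr => by
      rw [coe_unit n hr, norm_unit n hr, hfc]
      ring)]
  rw [polar (fun n => (n : E3) i * (n : E3) j * c n) _
    (fun r => r ^ m * r ^ 2 * (4 * deriv (deriv θ) (r ^ 2)))
    (fun n r hr => by
      rw [coe_unit n hr, norm_unit n hr, hfc]
      simp only [PiLp.smul_apply, smul_eq_mul]
      ring)]
  have j1 := hθ.ibp m
  have j2 := hd.ibp (m + 2)
  have k1 : ∫ r in Set.Ioi (0 : ℝ), r ^ 2 * (r ^ m * (2 * deriv θ (r ^ 2)))
      = ∫ r in Set.Ioi (0 : ℝ), 2 * r ^ (m + 2) * deriv θ (r ^ 2) := by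
    congr 1; ext r; ring
  have k2 : ∫ r in Set.Ioi (0 : ℝ), r ^ 2 * (r ^ m * r ^ 2 * (4 * deriv (deriv θ) (r ^ 2)))
      = 2 * ∫ r in Set.Ioi (0 : ℝ), 2 * r ^ (m + 2 + 2) * deriv (deriv θ) (r ^ 2) := by
    rw [← integral_const_mul]
    congr 1; ext r; ring
  have k3 : ∫ r in Set.Ioi (0 : ℝ), 2 * r ^ (m + 2) * deriv θ (r ^ 2)
      = 2 * ∫ r in Set.Ioi (0 : ℝ), r ^ (m + 2) * deriv θ (r ^ 2) := by
    rw [← integral_const_mul]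
    congr 1; ext r; ring
  rw [integral_const_mul, k1, k2, j2, j1]
  have k4 : ∫ r in Set.Ioi (0 : ℝ), r ^ (m + 2) * deriv θ (r ^ 2)
      = - ((m + 1) * ∫ r in Set.Ioi (0 : ℝ), r ^ m * θ (r ^ 2)) / 2 := by
    rw [← j1, k3]; ring
  rw [k4]
  push_cast
  ring

lemma trace_int {c : S2 → ℝ} (hc : Continuous c) :
    ∑ i : Fin 3, ∫ n, (n : E3) i * (n : E3) i * c n ∂dOmega = ∫ n, c n ∂dOmega := by
  rw [← integral_finsetSum]
  · congr 1
    ext n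
    have h : ‖(n : E3)‖ ^ 2 = 1 := by simp
    rw [EuclideanSpace.norm_sq_eq] at h
    simp only [Real.norm_eq_abs, sq_abs] at h
    rw [← Finset.sum_mul]
    simp_rw [← sq]
    rw [h, one_mul]
  · intro i _
    exact sphere_int (by fun_prop)

lemma rhs_trace {θ : ℝ → ℝ} (hθ : Prof θ) {f : E3 → ℝ} (hf : Continuous f) {c : S2 → ℝ}
    (hfc : ∀ n : S2, f n = c n) (m : ℕ) :
    ∫ z, (‖z‖ ^ m * f (‖z‖⁻¹ • z)) * ∑ i : Fin 3, pder i (pder i (fun z => θ (‖z‖ ^ 2))) z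
      = (m + 1) * m * (∫ r in Set.Ioi (0 : ℝ), r ^ m * θ (r ^ 2)) * ∫ n, c n ∂dOmega := by
  have hc : Continuous c := by
    have : c = fun n : S2 => f n := by ext n; exact (hfc n).symm
    rw [this]
    fun_prop
  simp_rw [Finset.mul_sum]
  rw [integral_finsetSum]
  · simp_rw [rhs_eval hθ hf hfc m]
    rw [← Finset.mul_sum, Finset.sum_sub_distrib, ← Finset.mul_sum, trace_int hc]
    simp
    ring
  · intro i _
    exact ann_int isOpen_ne ann_ne (hom_cont hf m)
      (pder_contDiff (pder_contDiff hθ.comp_smooth i) i).continuous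
      (pder_tsupport (pder_tsupport hθ.ann i) i)

lemma lap_tsupport {ψ : E3 → ℝ} (hs : tsupport ψ ⊆ Ann) :
    tsupport (fun z => ∑ i : Fin 3, pder i (pder i ψ) z) ⊆ Ann := by
  refine closure_minimal ?_ isCompact_Ann.isClosed
  intro z hz
  obtain ⟨i, -, hi⟩ := Finset.exists_ne_zero_of_sum_ne_zero hz
  exact pder_tsupport (pder_tsupport hs i) i (subset_tsupport _ hi)

lemma lap_cont {ψ : E3 → ℝ} (h : ContDiff ℝ (⊤ : ℕ∞) ψ) :
    Continuous (fun z => ∑ i : Fin 3, pder i (pder i ψ) z) :=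
  continuous_finsetSum _ fun i _ => (pder_contDiff (pder_contDiff h i) i).continuous

lemma ibp_lap {F : E3 → ℝ} {y : E3} {R : ℝ} (hF : ContDiffOn ℝ (⊤ : ℕ∞) F (PB y R))
    {ψ : E3 → ℝ} (hψ : ContDiff ℝ (⊤ : ℕ∞) ψ) (hs : tsupport ψ ⊆ Ann)
    {s : ℝ} (hs0 : 0 < s) (hsR : 3 * s < R) :
    s ^ 2 * ∫ z, (∑ i : Fin 3, pder i (pder i F) (y + s • z)) * ψ z
      = ∫ z, F (y + s • z) * ∑ i : Fin 3, pder i (pder i ψ) z := by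
  simp_rw [Finset.mul_sum, Finset.sum_mul]
  have hm : ContinuousOn (fun z : E3 => y + s • z) (WS s R) := by fun_prop
  rw [integral_finsetSum, integral_finsetSum, Finset.mul_sum]
  · exact Finset.sum_congr rfl fun i _ => ibp2 hF hψ hs i i hs0 hsR
  · intro i _
    exact ann_int (isOpen_WS s R) (ann_WS hs0 hsR)
      (hF.continuousOn.comp hm (WS_maps y hs0))
      (pder_contDiff (pder_contDiff hψ i) i).continuous
      (pder_tsupport (pder_tsupport hs i) i)
  · intro i _
    exact ann_int (isOpen_WS s R) (ann_WS hs0 hsR)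
      ((pder_contDiffOn (isOpen_PB y R) (pder_contDiffOn (isOpen_PB y R) hF i)
        i).continuousOn.comp hm (WS_maps y hs0)) hψ.continuous hs

/-- parties finies of second derivatives at the singular point:
`(∂_i∂_jF)_y = ((15nⁱnʲ − 3δ^{ij}) r⁻² F)_y`, and in particular
`(ΔF)_y = (6 r⁻² F)_y` and `(r² ΔF)_y = 0`. -/
theorem pf_of_second_derivatives_at_singularity
    (y : E3) (F : E3 → ℝ) (c : ℝ → S2 → ℝ)
    (hF : SmoothNearPunctured y F) (hFc : HasSingExpansion y F c)
    (h1 : ∀ i : Fin 3, ∃ c', HasSingExpansion y (pder i F) c')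
    (h2 : ∀ i j : Fin 3, ∃ c'', HasSingExpansion y (pder i (pder j F)) c'') :
    (∀ i j : Fin 3, ∀ q : ℝ → S2 → ℝ,
        HasSingExpansion y (pder i (pder j F)) q →
        pfAt q = (4 * π)⁻¹ * ∫ n : S2,
          (15 * (n : E3) i * (n : E3) j - 3 * (if i = j then (1 : ℝ) else 0)) * c 2 n ∂dOmega)
    ∧ (∀ q : ℝ → S2 → ℝ,
        HasSingExpansion y (fun x => ∑ i : Fin 3, pder i (pder i F) x) q →
        pfAt q = (4 * π)⁻¹ * ∫ n : S2, 6 * c 2 n ∂dOmega)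
    ∧ (∀ q : ℝ → S2 → ℝ,
        HasSingExpansion y (fun x => ‖x - y‖ ^ 2 * ∑ i : Fin 3, pder i (pder i F) x) q →
        pfAt q = 0) := by
  obtain ⟨U, hU, hFU⟩ := hF
  obtain ⟨R, hR, hRU⟩ := Metric.mem_nhds_iff.1 hU
  have hF' : ContDiffOn ℝ (⊤ : ℕ∞) F (PB y R) :=
    hFU.mono fun x hx => ⟨hRU hx.1, hx.2⟩
  have hPB := isOpen_PB y R
  have hF2 : ∀ i j, ContinuousOn (pder i (pder j F)) (PB y R) := fun i j =>
    (pder_contDiffOn hPB (pder_contDiffOn hPB hF' j) i).continuousOn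
  have hL : ContinuousOn (fun x => ∑ i : Fin 3, pder i (pder i F) x) (PB y R) :=
    continuousOn_finsetSum _ fun i _ => hF2 i i
  choose f hf hfc using hFc.smooth_coeffs
  have hfcont : ∀ a, Continuous (f a) := fun a => (hf a).continuous
  have hcc : Continuous (c 2) := by
    have : c 2 = fun n : S2 => f 2 n := by ext n; exact (hfc 2 n).symm
    rw [this]
    exact (hfcont 2).comp continuous_subtype_val
  obtain ⟨θ, hθ, hJ⟩ := exists_prof
  refine ⟨?_, ?_, ?_⟩
  · intro i j q hq
    choose g hg hgq using hq.smooth_coeffs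
    have h := compare hq hFc hR (hF2 i j) hF'.continuousOn (fun a => (hg a).continuous) hgq
      hfcont hfc hθ.comp_smooth.continuous hθ.ann
      (pder_contDiff (pder_contDiff hθ.comp_smooth i) j).continuous
      (pder_tsupport (pder_tsupport hθ.ann i) j) 2
      (fun s hs0 hsR => ibp2 hF' hθ.comp_smooth hθ.ann i j hs0 hsR)
    rw [lhs_eval (hgq 0), rhs_eval hθ (hfcont _) (hfc _) 2 i j] at h
    simp only [Nat.cast_ofNat] at h
    have h3 : ∫ n : S2, (15 * (n : E3) i * (n : E3) j - 3 * (if i = j then (1 : ℝ) else 0))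
        * c 2 n ∂dOmega = 15 * (∫ n, (n : E3) i * (n : E3) j * c 2 n ∂dOmega)
          - 3 * ((if i = j then 1 else 0) * ∫ n, c 2 n ∂dOmega) := by
      rw [← integral_const_mul, ← integral_const_mul, ← integral_const_mul, ← integral_sub]
      · congr 1; ext n; ring
      · exact sphere_int (by fun_prop)
      · exact sphere_int (by fun_prop)
    rw [pfAt, h3]
    congr 1
    apply mul_right_cancel₀ hJ.ne'
    rw [h]
    ring
  · intro q hq
    choose g hg hgq using hq.smooth_coeffs
    have h := compare hq hFc hR hL hF'.continuousOn (fun a => (hg a).continuous) hgq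
      hfcont hfc hθ.comp_smooth.continuous hθ.ann
      (lap_cont hθ.comp_smooth) (lap_tsupport hθ.ann) 2
      (fun s hs0 hsR => ibp_lap hF' hθ.comp_smooth hθ.ann hs0 hsR)
    rw [lhs_eval (hgq 0), rhs_trace hθ (hfcont _) (hfc _) 2] at h
    simp only [Nat.cast_ofNat] at h
    rw [pfAt, integral_const_mul]
    congr 1
    apply mul_right_cancel₀ hJ.ne'
    rw [h]
    ring
  · intro q hq
    choose g hg hgq using hq.smooth_coeffs
    have hθ1 : Prof (fun t => t * θ t) := hθ.mul contDiff_id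
    have hL' : ContinuousOn (fun x => ‖x - y‖ ^ 2 * ∑ i : Fin 3, pder i (pder i F) x)
        (PB y R) := ContinuousOn.mul (by fun_prop) hL
    have h := compare hq hFc hR hL' hF'.continuousOn (fun a => (hg a).continuous) hgq
      hfcont hfc hθ.comp_smooth.continuous hθ.ann
      (lap_cont hθ1.comp_smooth) (lap_tsupport hθ1.ann) 0
      (fun s hs0 hsR => by
        rw [← ibp_lap hF' hθ1.comp_smooth hθ1.ann hs0 hsR, pow_zero, one_mul,
          ← integral_const_mul]
        congr 1
        ext z
        simp only [add_sub_cancel_left, norm_smul, Real.norm_of_nonneg hs0.le]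
        ring)
    rw [lhs_eval (hgq 0), rhs_trace hθ1 (hfcont _) (hfc _) 0] at h
    simp only [Nat.cast_zero, mul_zero, zero_mul] at h
    rw [pfAt, (mul_eq_zero.1 h).resolve_right hJ.ne', mul_zero]

end
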